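/- Let L be a unimodular lattice in ℝ^n with n > 23 having no vectors of norm 1. Then L has a characteristic vector w with ⟪w,w⟫ < n − 8; equivalently, the number N₂ of vectors of norm 2 in L is strictly greater than 2n(23 − n). -/

import Mathlib

open scoped RealInnerProductSpace

/-- A unimodular (self-dual) lattice in `ℝⁿ`: a `ℤ`-submodule of Euclidean space that is
discrete, spans `ℝⁿ` over `ℝ`, and is self-dual: a vector `v` belongs to the lattice iff
its inner product with every lattice vector is an integer. -/
def IsUnimodularLattice (n : ℕ) (L : Submodule ℤ (EuclideanSpace ℝ (Fin n))) : Prop :=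
  DiscreteTopology L ∧
  Submodule.span ℝ (L : Set (EuclideanSpace ℝ (Fin n))) = ⊤ ∧
  ∀ v : EuclideanSpace ℝ (Fin n), v ∈ L ↔ ∀ y ∈ L, ∃ k : ℤ, ⟪v, y⟫ = (k : ℝ)

/-- A characteristic vector of a lattice `L`: a vector `w ∈ L` with
`⟪w,x⟫ ≡ ⟪x,x⟫ (mod 2)` for all `x ∈ L`. -/
def IsCharacteristic (n : ℕ) (L : Submodule ℤ (EuclideanSpace ℝ (Fin n)))
    (w : EuclideanSpace ℝ (Fin n)) : Prop :=
  w ∈ L ∧ ∀ x ∈ L, ∃ k : ℤ, ⟪w, x⟫ - ⟪x, x⟫ = 2 * (k : ℝ)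

section work
open UpperHalfPlane hiding I
open ModularForm Filter Topology Complex Asymptotics
open scoped Manifold MatrixGroups Real
open MeasureTheory


lemma wt_zero_vanish (R : ℍ → ℂ) (hd : MDiff R)
    (hS : ∀ τ : ℍ, R (ModularGroup.S • τ) = R τ) (hT : ∀ τ : ℍ, R (ModularGroup.T • τ) = R τ)
    (h0 : Tendsto R atImInfty (𝓝 0)) : ∀ τ, R τ = 0 := by
  have hinv : ∀ γ : SL(2, ℤ), R ∣[(0:ℤ)] γ = R := by
    apply SlashInvariantForm.slash_action_generators_SL2Z
    · ext τ; rw [SL_slash_apply, hS]; simp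
    · ext τ; rw [SL_slash_apply, hT]; simp
  let f : ModularForm (Matrix.SpecialLinearGroup.mapGL ℝ : SL(2, ℤ) →* GL (Fin 2) ℝ).range 0 :=
    { toFun := R
      slash_action_eq' := fun _ ⟨γ, hγ⟩ ↦ hγ ▸ hinv γ
      holo' := hd
      bdd_at_cusps' := by
        intro c hc
        rw [Subgroup.IsArithmetic.isCusp_iff_isCusp_SL2Z] at hc
        rw [OnePoint.isBoundedAt_iff_forall_SL2Z hc]
        intro γ _
        rw [hinv γ, IsBoundedAtImInfty, BoundedAtFilter]
        exact h0.isBigO_one ℝ }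
  obtain ⟨c, hc⟩ := ModularFormClass.levelOne_weight_zero_const f
  have hR : R = fun _ => c := hc
  have : c = 0 := by
    rw [hR] at h0
    exact tendsto_nhds_unique tendsto_const_nhds h0
  intro τ
  rw [hR, this]

/-- the upper half plane as a subset of `ℂ` -/
def UU : Set ℂ := {z : ℂ | 0 < z.im}

lemma UU_open : IsOpen UU := isOpen_lt continuous_const Complex.continuous_im

lemma UU_preconn : IsPreconnected UU := (convex_halfSpace_im_gt 0).isPreconnected

lemma UU_an {f : ℂ → ℂ} (hf : DifferentiableOn ℂ f UU) : AnalyticOnNhd ℂ f UU :=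
  hf.analyticOnNhd UU_open

lemma eqOn_UU_of_imag {f g : ℂ → ℂ} (hf : DifferentiableOn ℂ f UU) (hg : DifferentiableOn ℂ g UU)
    (h : ∀ t : ℝ, 0 < t → f (I * t) = g (I * t)) : ∀ z ∈ UU, f z = g z := by
  have hI : (I : ℂ) ∈ UU := by simp [UU]
  refine (UU_an hf).eqOn_of_preconnected_of_frequently_eq (UU_an hg) UU_preconn hI ?_
  have ht : Tendsto (fun t : ℝ => I * (t : ℂ)) (𝓝[≠] 1) (𝓝[≠] I) := by
    rw [tendsto_nhdsWithin_iff]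
    constructor
    · have : Tendsto (fun t : ℝ => I * (t : ℂ)) (𝓝 1) (𝓝 (I * ((1 : ℝ) : ℂ))) :=
        Continuous.tendsto (by fun_prop) 1
      simp at this
      exact this.mono_left nhdsWithin_le_nhds
    · filter_upwards [self_mem_nhdsWithin] with t ht h
      apply ht
      have h2 : (t : ℂ) = 1 := by
        apply mul_left_cancel₀ I_ne_zero; simpa using h
      exact_mod_cast h2
  refine ht.frequently ?_
  apply Eventually.frequently
  have : ∀ᶠ t : ℝ in 𝓝 1, 0 < t := lt_mem_nhds one_pos
  filter_upwards [this.filter_mono nhdsWithin_le_nhds] with t ht using h t ht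

lemma UU_S {z : ℂ} (hz : z ∈ UU) : -1 / z ∈ UU := by
  have hz' : 0 < z.im := hz
  change 0 < (-1 / z).im
  have h0 : z ≠ 0 := by rintro rfl; simp at hz'
  rw [neg_div, one_div, Complex.neg_im, Complex.inv_im, neg_div, neg_neg]
  exact div_pos hz' (Complex.normSq_pos.mpr h0)

lemma UU_add {z : ℂ} (hz : z ∈ UU) (r : ℝ) : z + r ∈ UU := by simpa [UU] using hz

lemma UU_add1 {z : ℂ} (hz : z ∈ UU) : z + 1 ∈ UU := by simpa [UU] using hz

lemma UU_ne {z : ℂ} (hz : z ∈ UU) : z ≠ 0 := by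
  rintro rfl; simp [UU] at hz

lemma diff_S : DifferentiableOn ℂ (fun z : ℂ => -1 / z) UU := fun _ hz =>
  ((differentiableAt_const _).div differentiableAt_id (UU_ne hz)).differentiableWithinAt

/-- the discriminant as a function on `ℂ` -/
noncomputable def DD (z : ℂ) : ℂ := ModularForm.eta z ^ 24

lemma DD_eq (τ : ℍ) : ModularForm.discriminant τ = DD τ := rfl

lemma DD_ne {z : ℂ} (hz : z ∈ UU) : DD z ≠ 0 := ModularForm.discriminant_ne_zero ⟨z, hz⟩

lemma DD_diff : DifferentiableOn ℂ DD UU := fun z hz =>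
  ((differentiableAt_eta_of_mem_upperHalfPlaneSet hz).pow 24).differentiableWithinAt

lemma DD_T' (τ : ℍ) : DD (τ + 1) = DD τ := by
  have h := congrFun ModularForm.discriminant_T_invariant τ
  have hd : denom (Matrix.SpecialLinearGroup.toGL
      ((Matrix.SpecialLinearGroup.map (Int.castRingHom ℝ)) ModularGroup.T)) (τ : ℂ) = 1 := by
    have := ModularGroup.denom_apply ModularGroup.T τ
    simp [ModularGroup.T] at this
    simpa [ModularGroup.T] using this
  rw [SL_slash_apply, UpperHalfPlane.modular_T_smul, DD_eq, DD_eq, hd] at h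
  simpa [add_comm] using h

lemma DD_T {z : ℂ} (hz : z ∈ UU) : DD (z + 1) = DD z := DD_T' ⟨z, hz⟩

lemma DD_S' (τ : ℍ) : DD (-1 / τ) = (τ : ℂ) ^ 12 * DD τ := by
  have h := congrFun ModularForm.discriminant_S_invariant τ
  have h0 : (τ : ℂ) ≠ 0 := UpperHalfPlane.ne_zero τ
  rw [SL_slash_apply, UpperHalfPlane.modular_S_smul, DD_eq, DD_eq, ModularGroup.denom_S] at h
  rw [← h, show -1 / (τ : ℂ) = (-(τ : ℂ))⁻¹ by rw [inv_neg, neg_div, one_div]]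
  simp [zpow_neg]
  field_simp

lemma DD_S {z : ℂ} (hz : z ∈ UU) : DD (-1 / z) = z ^ 12 * DD z := DD_S' ⟨z, hz⟩


/-- the filter `Im z → ∞` -/
def LL : Filter ℂ := comap Complex.im atTop

lemma tendsto_coe_LL : Tendsto (fun τ : ℍ => (τ : ℂ)) atImInfty LL := by
  rw [LL, tendsto_comap_iff]
  exact tendsto_comap

lemma modular_main (n : ℕ) (H0 H2 : ℂ → ℂ) (d0 : DifferentiableOn ℂ H0 UU)
    (d2 : DifferentiableOn ℂ H2 UU) (h1 : ∀ z ∈ UU, H0 (z + 2) = H0 z)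
    (h2 : ∀ t : ℝ, 0 < t → H0 (I * (t⁻¹ : ℝ)) = ((√t : ℝ) : ℂ) ^ n * H0 (I * t))
    (h3 : ∀ t : ℝ, 0 < t → H0 (I * (t⁻¹ : ℝ) + 1) = ((√t : ℝ) : ℂ) ^ n * H2 (I * t))
    (g0 : H0 =O[LL] fun z => rexp (-(2 * π * z.im)))
    (g2 : H2 =O[LL] fun z => rexp (-(π * ((n : ℝ) - 8) / 4 * z.im))) :
    ∀ z ∈ UU, H0 z = 0 := by
  have hIt : ∀ t : ℝ, 0 < t → I * (t : ℂ) ∈ UU := fun t ht => by simpa [UU] using ht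
  have hSI : ∀ t : ℝ, 0 < t → -1 / (I * (t : ℂ)) = I * (t⁻¹ : ℝ) := by
    intro t ht
    have : (t : ℂ) ≠ 0 := by exact_mod_cast ht.ne'
    push_cast
    field_simp
    simp
  have hroot : ∀ t : ℝ, 0 < t → (((√t : ℝ) : ℂ) ^ n) ^ 24 = (I * (t : ℂ)) ^ (12 * n) := by
    intro t ht
    have h : ((√t : ℝ) : ℂ) ^ 2 = t := by exact_mod_cast Real.sq_sqrt ht.le
    rw [← pow_mul, mul_pow, mul_comm n 24, show 24 * n = 2 * (12 * n) by ring, pow_mul, h]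
    rw [pow_mul I, show (12 : ℕ) = 4 * 3 by rfl, pow_mul I, I_pow_four]
    simp
  have dS0 : DifferentiableOn ℂ (fun z => H0 (-1 / z)) UU :=
    d0.comp diff_S (fun z hz => UU_S hz)
  have dT0 : DifferentiableOn ℂ (fun z => H0 (z + 1)) UU :=
    d0.comp (by fun_prop) (fun z hz => UU_add1 hz)
  have dTS0 : DifferentiableOn ℂ (fun z => H0 (-1 / z + 1)) UU :=
    dT0.comp diff_S (fun z hz => UU_S hz)
  have e2 : ∀ z ∈ UU, H0 (-1 / z) ^ 24 = z ^ (12 * n) * H0 z ^ 24 := by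
    apply eqOn_UU_of_imag (f := fun z => H0 (-1 / z) ^ 24)
      (g := fun z => z ^ (12 * n) * H0 z ^ 24) (dS0.pow 24)
    · exact DifferentiableOn.mul (by fun_prop) (d0.pow 24)
    · intro t ht
      simp only [hSI t ht, h2 t ht, mul_pow _ _ 24, hroot t ht]
  have e3 : ∀ z ∈ UU, H0 (-1 / z + 1) ^ 24 = z ^ (12 * n) * H2 z ^ 24 := by
    apply eqOn_UU_of_imag (f := fun z => H0 (-1 / z + 1) ^ 24)
      (g := fun z => z ^ (12 * n) * H2 z ^ 24) (dTS0.pow 24)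
    · exact DifferentiableOn.mul (by fun_prop) (d2.pow 24)
    · intro t ht
      simp only [hSI t ht, h3 t ht, mul_pow _ _ 24, hroot t ht]
  let R0 : ℂ → ℂ := fun z => H0 z ^ 24 / DD z ^ n
  have r2 : ∀ z ∈ UU, R0 (z + 2) = R0 z := by
    intro z hz
    simp only [R0]
    rw [h1 z hz, show z + 2 = (z + 1) + 1 by ring, DD_T (UU_add1 hz), DD_T hz]
  have rS : ∀ z ∈ UU, R0 (-1 / z) = R0 z := by
    intro z hz
    have h0 := UU_ne hz
    have h0' := DD_ne hz
    simp only [R0]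
    rw [e2 z hz, DD_S hz, mul_pow, ← pow_mul]
    rw [mul_div_mul_left _ _ (pow_ne_zero _ h0)]
  have rTS : ∀ z ∈ UU, R0 (-1 / z + 1) = H2 z ^ 24 / DD z ^ n := by
    intro z hz
    have h0 := UU_ne hz
    have h0' := DD_ne hz
    simp only [R0]
    rw [e3 z hz, DD_T (UU_S hz), DD_S hz, mul_pow, ← pow_mul]
    rw [mul_div_mul_left _ _ (pow_ne_zero _ h0)]
  have dR0 : DifferentiableOn ℂ R0 UU :=
    (d0.pow 24).div (DD_diff.pow n) (fun z hz => pow_ne_zero _ (DD_ne hz))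
  have dR1 : DifferentiableOn ℂ (fun z => R0 (z + 1)) UU :=
    dR0.comp (by fun_prop) (fun z hz => UU_add1 hz)
  have dR2 : DifferentiableOn ℂ (fun z => R0 (-1 / z + 1)) UU :=
    dR1.comp diff_S (fun z hz => UU_S hz)
  let K : ℂ → ℂ := fun z => R0 z * (R0 (z + 1) * R0 (-1 / z + 1))
  have dK : DifferentiableOn ℂ K UU := dR0.mul (dR1.mul dR2)
  have KT : ∀ z ∈ UU, K (z + 1) = K z := by
    intro z hz
    have h0 := UU_ne hz
    have h0' := UU_ne (UU_add1 hz)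
    have a1 : R0 (z + 1 + 1) = R0 z := by
      rw [← r2 z hz]; congr 1; ring
    have a2 : R0 (-1 / (z + 1) + 1) = R0 (-1 / z + 1) := by
      have hz2 : -1 / (z + 1) + 1 ∈ UU := UU_add1 (UU_S (UU_add1 hz))
      rw [← rS _ hz2]
      have hne := UU_ne hz2
      have hw : -1 / (-1 / (z + 1) + 1) ∈ UU := UU_S hz2
      rw [← r2 _ hw]
      congr 1
      have : -1 / (z + 1) + 1 = z / (z + 1) := by field_simp; ring
      rw [this]
      field_simp
      ring
    simp only [K, a1, a2]
    ring
  have KS : ∀ z ∈ UU, K (-1 / z) = K z := by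
    intro z hz
    have h0 := UU_ne hz
    have a1 : -1 / (-1 / z) = z := by field_simp
    simp only [K, a1, rS z hz]
    ring
  have Kz : ∀ z ∈ UU, K z = 0 := by
    have key := wt_zero_vanish (fun τ : ℍ => K τ) ?_ ?_ ?_ ?_
    · intro z hz; exact key ⟨z, hz⟩
    · rw [UpperHalfPlane.mdifferentiable_iff]
      refine dK.congr fun z hz => ?_
      simp [ofComplex_apply_of_im_pos hz]
    · intro τ
      rw [UpperHalfPlane.modular_S_smul, ← KS τ τ.2]
      congr 1
      simp [neg_div, inv_neg]
    · intro τ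
      rw [UpperHalfPlane.modular_T_smul, ← KT τ τ.2]
      congr 1
      simp [add_comm]
    · -- growth
      have hD : (fun τ : ℍ => (DD τ ^ n)⁻¹) =O[atImInfty] fun τ => (rexp (-2 * π * τ.im) ^ n)⁻¹ := by
        refine IsBigO.inv_rev (exp_isBigO_discriminant.pow n) (Eventually.of_forall ?_)
        intro τ h
        exact absurd h (pow_ne_zero _ (Real.exp_ne_zero _))
      have b0 : (fun τ : ℍ => R0 τ) =O[atImInfty] fun τ =>
          rexp (-(2 * π * τ.im)) ^ 24 * (rexp (-2 * π * τ.im) ^ n)⁻¹ := by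
        simp only [R0, div_eq_mul_inv]
        exact ((g0.comp_tendsto tendsto_coe_LL).pow 24).mul hD
      have tT : Tendsto (fun τ : ℍ => (τ : ℂ) + 1) atImInfty LL := by
        rw [LL, tendsto_comap_iff]
        have : (Complex.im ∘ fun τ : ℍ => (τ : ℂ) + 1) = UpperHalfPlane.im := by
          ext τ; simp
        rw [this]
        exact tendsto_comap
      have b1 : (fun τ : ℍ => R0 (τ + 1)) =O[atImInfty] fun τ =>
          rexp (-(2 * π * τ.im)) ^ 24 * (rexp (-2 * π * τ.im) ^ n)⁻¹ := by
        have : (fun τ : ℍ => R0 (τ + 1)) = fun τ : ℍ => H0 (τ + 1) ^ 24 * (DD τ ^ n)⁻¹ := by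
          ext τ
          simp only [R0, div_eq_mul_inv]
          rw [DD_T τ.2]
        rw [this]
        refine IsBigO.mul ?_ hD
        refine IsBigO.pow ?_ 24
        refine ((g0.comp_tendsto tT).trans ?_)
        apply IsBigO.of_bound 1
        refine Eventually.of_forall fun τ => ?_
        simp
      have b2 : (fun τ : ℍ => R0 (-1 / (τ : ℂ) + 1)) =O[atImInfty] fun τ =>
          rexp (-(π * ((n : ℝ) - 8) / 4 * τ.im)) ^ 24 * (rexp (-2 * π * τ.im) ^ n)⁻¹ := by
        have : (fun τ : ℍ => R0 (-1 / (τ : ℂ) + 1)) = fun τ : ℍ => H2 τ ^ 24 * (DD τ ^ n)⁻¹ := by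
          ext τ
          rw [rTS τ τ.2, div_eq_mul_inv]
        rw [this]
        exact ((g2.comp_tendsto tendsto_coe_LL).pow 24).mul hD
      have b := b0.mul (b1.mul b2)
      refine b.trans_tendsto ?_
      have : ∀ y : ℝ, rexp (-(2 * π * y)) ^ 24 * (rexp (-2 * π * y) ^ n)⁻¹ *
          (rexp (-(2 * π * y)) ^ 24 * (rexp (-2 * π * y) ^ n)⁻¹ *
            (rexp (-(π * ((n : ℝ) - 8) / 4 * y)) ^ 24 * (rexp (-2 * π * y) ^ n)⁻¹)) =
          rexp (-(48 * π * y)) := by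
        intro y
        simp only [← Real.exp_nat_mul, ← Real.exp_neg, ← Real.exp_add]
        congr 1
        push_cast
        ring
      simp only [this]
      have t1 : Tendsto (fun y : ℝ => rexp (-(48 * π * y))) atTop (𝓝 0) := by
        refine Real.tendsto_exp_neg_atTop_nhds_zero.comp ?_
        exact tendsto_id.const_mul_atTop (by positivity)
      exact t1.comp tendsto_comap
  have Rz : ∀ z ∈ UU, R0 z = 0 := by
    rcases (UU_an dR0).eq_zero_or_eq_zero_of_mul_eq_zero (UU_an (dR1.mul dR2)) Kz UU_preconn with
      h | h
    · exact h
    rcases (UU_an dR1).eq_zero_or_eq_zero_of_mul_eq_zero (UU_an dR2) h UU_preconn with h | h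
    · intro z hz
      have := h (z + ((-1 : ℝ) : ℂ)) (UU_add hz _)
      simpa using this
    · intro z hz
      have hz1 : z + ((-1 : ℝ) : ℂ) ∈ UU := UU_add hz _
      have h0 := UU_ne hz1
      have := h _ (UU_S hz1)
      rw [show -1 / (-1 / (z + ((-1 : ℝ) : ℂ))) + 1 = z by field_simp; push_cast; ring] at this
      exact this
  intro z hz
  have := Rz z hz
  simp only [R0, div_eq_zero_iff] at this
  rcases this with h | h
  · exact pow_eq_zero_iff (by norm_num) |>.mp h
  · exact absurd h (pow_ne_zero _ (DD_ne hz))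


/-- generalised theta series `∑ exp(π i ρ z)` -/
noncomputable def gth {ι : Type*} (ρ : ι → ℝ) (z : ℂ) : ℂ := ∑' i, cexp (π * I * ρ i * z)

/-- admissible exponent families -/
def Adm {ι : Type*} (ρ : ι → ℝ) : Prop :=
  (∀ i, 0 ≤ ρ i) ∧ ∀ s : ℝ, 0 < s → Summable fun i => rexp (-(s * ρ i))

lemma norm_term (r : ℝ) (z : ℂ) : ‖cexp (π * I * r * z)‖ = rexp (-(π * z.im * r)) := by
  rw [Complex.norm_exp]
  congr 1
  simp
  ring

lemma gth_summable {ι : Type*} {ρ : ι → ℝ} (h : Adm ρ) {z : ℂ} (hz : z ∈ UU) :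
    Summable fun i => cexp (π * I * ρ i * z) := by
  apply Summable.of_norm
  simp only [norm_term]
  exact h.2 _ (mul_pos Real.pi_pos hz)

lemma gth_diff {ι : Type*} {ρ : ι → ℝ} (h : Adm ρ) : DifferentiableOn ℂ (gth ρ) UU := by
  intro z hz
  have hz' : 0 < z.im := hz
  have ho : IsOpen {w : ℂ | z.im / 2 < w.im} := isOpen_lt continuous_const Complex.continuous_im
  have hd : DifferentiableOn ℂ (gth ρ) {w : ℂ | z.im / 2 < w.im} := by
    refine differentiableOn_tsum_of_summable_norm (h.2 (π * (z.im / 2)) (by positivity)) ?_ ho ?_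
    · intro i; fun_prop
    · intro i w hw
      rw [norm_term]
      apply Real.exp_le_exp.mpr
      have hw' : z.im / 2 < w.im := hw
      have := h.1 i
      have := Real.pi_pos
      gcongr
  have hm : z ∈ {w : ℂ | z.im / 2 < w.im} := by
    change z.im / 2 < z.im; linarith
  exact (hd.differentiableAt (ho.mem_nhds hm)).differentiableWithinAt

lemma gth_bound {ι : Type*} {ρ : ι → ℝ} (h : Adm ρ) (m : ℝ) (hm : ∀ i, m ≤ ρ i) :
    gth ρ =O[LL] fun z => rexp (-(π * m * z.im)) := by
  apply IsBigO.of_bound (rexp (π * m) * ∑' i, rexp (-(π * ρ i)))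
  have : ∀ᶠ z in LL, 1 ≤ z.im := tendsto_comap.eventually (eventually_ge_atTop 1)
  filter_upwards [this] with z hz
  have hpi := Real.pi_pos
  have hs := h.2 π hpi
  have key : ∀ i, ‖cexp (π * I * ρ i * z)‖ ≤
      rexp (-(π * ρ i)) * (rexp (π * m) * rexp (-(π * m * z.im))) := by
    intro i
    rw [norm_term, ← Real.exp_add, ← Real.exp_add]
    apply Real.exp_le_exp.mpr
    have : 0 ≤ π * ((ρ i - m) * (z.im - 1)) :=
      mul_nonneg hpi.le (mul_nonneg (by linarith [hm i]) (by linarith))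
    nlinarith
  have h2 := tsum_of_norm_bounded (hs.hasSum.mul_right _) key
  rw [Real.norm_of_nonneg (Real.exp_nonneg _)]
  calc ‖gth ρ z‖ ≤ _ := h2
    _ = _ := by ring

lemma Adm.sub {ι : Type*} {ρ : ι → ℝ} (h : Adm ρ) (s : Set ι) :
    Adm (fun i : s => ρ i) :=
  ⟨fun i => h.1 i, fun t ht => (h.2 t ht).comp_injective Subtype.val_injective⟩

lemma gth_split {ι : Type*} {ρ : ι → ℝ} (h : Adm ρ) (s : Finset ι) {z : ℂ} (hz : z ∈ UU) :
    gth ρ z = ∑ i ∈ s, cexp (π * I * ρ i * z) + gth (fun i : {i // i ∉ s} => ρ i) z := by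
  have := (gth_summable h hz).sum_add_tsum_subtype_compl s
  exact this.symm

lemma Adm.sub' {ι : Type*} {ρ : ι → ℝ} (h : Adm ρ) (s : Finset ι) :
    Adm (fun i : {i // i ∉ s} => ρ i) :=
  ⟨fun i => h.1 i, fun t ht => (h.2 t ht).comp_injective Subtype.val_injective⟩

lemma UU_eventually : ∀ᶠ z in LL, z ∈ UU := by
  have : ∀ᶠ z in LL, 1 ≤ z.im := tendsto_comap.eventually (eventually_ge_atTop 1)
  filter_upwards [this] with z hz
  exact lt_of_lt_of_le one_pos hz

/-! ### the classical theta functions -/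

noncomputable def r3 (m : ℤ) : ℝ := (m : ℝ) ^ 2
noncomputable def r2 (m : ℤ) : ℝ := ((m : ℝ) + 1 / 2) ^ 2

noncomputable def th3 (z : ℂ) : ℂ := gth r3 z
noncomputable def th2 (z : ℂ) : ℂ := gth r2 z
noncomputable def th4 (z : ℂ) : ℂ := gth r3 (z + 1)

lemma adm_r3 : Adm r3 := by
  refine ⟨fun i => sq_nonneg _, fun s hs => ?_⟩
  have := (summable_pow_mul_jacobiTheta₂_term_bound 0 (T := s / π) (by positivity) 0)
  refine this.congr fun m => ?_
  simp [r3]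
  field_simp

lemma adm_r2 : Adm r2 := by
  refine ⟨fun i => sq_nonneg _, fun s hs => ?_⟩
  have h := (adm_r3.2 (s / 2) (by positivity)).mul_left (rexp (s / 4))
  refine Summable.of_nonneg_of_le (fun _ => (Real.exp_pos _).le) (fun m => ?_) h
  rw [← Real.exp_add]
  apply Real.exp_le_exp.mpr
  simp only [r2, r3]
  nlinarith [mul_nonneg hs.le (sq_nonneg ((m : ℝ) + 1))]

lemma exp_pi_even (k : ℤ) : cexp (π * I * (2 * k)) = 1 := by
  rw [show (π : ℂ) * I * (2 * k) = k * (2 * π * I) by ring]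
  exact Complex.exp_int_mul_two_pi_mul_I k

lemma th3_two (z : ℂ) : th3 (z + 2) = th3 z := by
  unfold th3 gth
  refine tsum_congr fun m => ?_
  rw [mul_add, Complex.exp_add]
  have := exp_pi_even (m ^ 2)
  rw [show (π : ℂ) * I * (r3 m : ℝ) * 2 = π * I * (2 * ((m ^ 2 : ℤ) : ℂ)) by
    simp [r3]; ring, this, mul_one]

lemma th4_two (z : ℂ) : th4 (z + 2) = th4 z := by
  have := th3_two (z + 1)
  unfold th4
  unfold th3 at this
  rw [← this]; congr 1; ring

lemma th4_one (z : ℂ) : th4 (z + 1) = th3 z := by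
  rw [← th3_two z]
  unfold th4 th3; congr 1; ring

lemma th3_one (z : ℂ) : th3 (z + 1) = th4 z := rfl

lemma th2_one (z : ℂ) : th2 (z + 1) = cexp (π * I / 4) * th2 z := by
  unfold th2 gth
  rw [← tsum_mul_left]
  refine tsum_congr fun m => ?_
  rw [mul_add, Complex.exp_add, mul_comm]
  congr 1
  obtain ⟨k, hk⟩ := Int.even_mul_succ_self m
  have hk' : (m : ℂ) * (m + 1) = k + k := by exact_mod_cast hk
  have := exp_pi_even k
  rw [show (π : ℂ) * I * (r2 m : ℝ) * 1 = π * I / 4 + π * I * (2 * k) by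
    simp [r2]; linear_combination (π : ℂ) * I * hk', Complex.exp_add, this, mul_one]

lemma exp_pi_four : cexp (π * I / 4) ^ 4 = -1 := by
  rw [← Complex.exp_nat_mul, ← Complex.exp_pi_mul_I]; congr 1; push_cast; ring

lemma th2_pow_one (z : ℂ) : th2 (z + 1) ^ 4 = - th2 z ^ 4 := by
  rw [th2_one, mul_pow, exp_pi_four]; ring

lemma th2_pow_two (z : ℂ) : th2 (z + 2) ^ 4 = th2 z ^ 4 := by
  rw [show z + 2 = (z + 1) + 1 by ring, th2_pow_one, th2_pow_one]; ring

lemma I_sq_mul (t : ℝ) (r : ℝ) : π * I * r * (I * t) = ((-(π * t * r) : ℝ) : ℂ) := by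
  push_cast
  linear_combination (π : ℂ) * r * t * I_mul_I

lemma cpow_half (t : ℝ) (ht : 0 < t) : ((t : ℂ)) ^ (1 / 2 : ℂ) = ((√t : ℝ) : ℂ) := by
  rw [Real.sqrt_eq_rpow, Complex.ofReal_cpow ht.le]
  simp

lemma th3_S (t : ℝ) (ht : 0 < t) : th3 (I * (t⁻¹ : ℝ)) = ((√t : ℝ) : ℂ) * th3 (I * t) := by
  have h := Complex.tsum_exp_neg_mul_int_sq (a := (t : ℂ)) (by simpa using ht)
  have hs : ((√t : ℝ) : ℂ) ≠ 0 := by exact_mod_cast (Real.sqrt_pos.mpr ht).ne'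
  have ht0 : (t : ℂ) ≠ 0 := by exact_mod_cast ht.ne'
  rw [cpow_half t ht] at h
  have e1 : th3 (I * t) = ∑' n : ℤ, cexp (-π * t * (n : ℂ) ^ 2) := by
    unfold th3 gth
    refine tsum_congr fun m => ?_
    rw [I_sq_mul]; simp [r3]
  have e2 : th3 (I * (t⁻¹ : ℝ)) = ∑' n : ℤ, cexp (-π / t * (n : ℂ) ^ 2) := by
    unfold th3 gth
    refine tsum_congr fun m => ?_
    rw [I_sq_mul]; simp [r3]; congr 1; field_simp
  rw [e1, e2, h]
  field_simp

lemma th4_S (t : ℝ) (ht : 0 < t) : th4 (I * (t⁻¹ : ℝ)) = ((√t : ℝ) : ℂ) * th2 (I * t) := by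
  have hti : 0 < t⁻¹ := inv_pos.mpr ht
  have h := Complex.tsum_exp_neg_quadratic (a := ((t⁻¹ : ℝ) : ℂ)) (by simpa using ht) (-I / 2)
  have hs : ((√t : ℝ) : ℂ) ≠ 0 := by exact_mod_cast (Real.sqrt_pos.mpr ht).ne'
  have ht0 : (t : ℂ) ≠ 0 := by exact_mod_cast ht.ne'
  rw [cpow_half _ hti] at h
  have e1 : th4 (I * (t⁻¹ : ℝ)) =
      ∑' n : ℤ, cexp (-π * ((t⁻¹ : ℝ) : ℂ) * (n : ℂ) ^ 2 + 2 * π * (-I / 2) * n) := by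
    unfold th4 gth
    refine tsum_congr fun m => ?_
    rw [mul_add, I_sq_mul, Complex.exp_add, Complex.exp_add]
    congr 1
    · simp [r3]
    · obtain ⟨k, hk⟩ := Int.even_mul_succ_self m
      have hk' : (m : ℂ) * (m + 1) = k + k := by exact_mod_cast hk
      have := exp_pi_even k
      rw [show (π : ℂ) * I * (r3 m : ℝ) * 1 = 2 * π * (-I / 2) * m + π * I * (2 * k) by
        simp [r3]; linear_combination (π : ℂ) * I * hk', Complex.exp_add, this, mul_one]
  have e2 : th2 (I * t) = ∑' n : ℤ, cexp (-π / ((t⁻¹ : ℝ) : ℂ) * (n + I * (-I / 2)) ^ 2) := by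
    unfold th2 gth
    refine tsum_congr fun m => ?_
    rw [I_sq_mul]
    congr 1
    have : I * (-I / 2) = 1 / 2 := by linear_combination (-1 / 2 : ℂ) * I_mul_I
    rw [this]
    simp [r2]
  rw [e1, e2, h, Real.sqrt_inv]
  push_cast
  simp

lemma th2_S (t : ℝ) (ht : 0 < t) : th2 (I * (t⁻¹ : ℝ)) = ((√t : ℝ) : ℂ) * th4 (I * t) := by
  have h := th4_S t⁻¹ (inv_pos.mpr ht)
  have hs : ((√t : ℝ) : ℂ) ≠ 0 := by exact_mod_cast (Real.sqrt_pos.mpr ht).ne'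
  rw [inv_inv] at h
  rw [h, Real.sqrt_inv]
  push_cast
  field_simp

lemma th3_diff : DifferentiableOn ℂ th3 UU := gth_diff adm_r3
lemma th2_diff : DifferentiableOn ℂ th2 UU := gth_diff adm_r2
lemma th4_diff : DifferentiableOn ℂ th4 UU :=
  th3_diff.comp (f := fun z => z + 1) (by fun_prop) (fun z hz => UU_add1 hz)



/-! ### Poisson summation on `ℝ^d` -/

/-- integer points -/
def zr {d : Type*} (m : d → ℤ) : d → ℝ := fun i => (m i : ℝ)

/-- unit cubes -/
def cube {d : Type*} (m : d → ℤ) : Set (d → ℝ) :=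
  {x | ∀ i, x i ∈ Set.Ioc ((m i : ℝ)) ((m i : ℝ) + 1)}

lemma cube_meas {d : Type*} [Fintype d] (m : d → ℤ) : MeasurableSet (cube m) :=
  MeasurableSet.univ_pi' (fun i => measurableSet_Ioc)

lemma mem_cube {d : Type*} (m : d → ℤ) (x : d → ℝ) : x ∈ cube m ↔ ∀ i, ⌈x i⌉ = m i + 1 := by
  unfold cube
  simp only [Set.mem_ofPred_eq, Set.mem_Ioc, Int.ceil_eq_iff]
  push_cast
  simp

lemma cube_disj {d : Type*} : Pairwise (Function.onFun Disjoint (cube : (d → ℤ) → Set (d → ℝ))) := by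
  intro m m' h
  rw [Function.onFun, Set.disjoint_left]
  intro x hx hx'
  rw [mem_cube] at hx hx'
  apply h
  funext i
  have := hx i
  have := hx' i
  omega

lemma cube_union {d : Type*} : (⋃ m : d → ℤ, cube m) = Set.univ := by
  rw [Set.eq_univ_iff_forall]
  intro x
  rw [Set.mem_iUnion]
  refine ⟨fun i => ⌈x i⌉ - 1, ?_⟩
  rw [mem_cube]
  intro i; ring

lemma cube_int {d : Type*} [Fintype d] {E : Type*} [NormedAddCommGroup E] [NormedSpace ℝ E]
    (g : (d → ℝ) → E) (m : d → ℤ) :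
    ∫ x in cube 0, g (x + zr m) = ∫ x in cube m, g x := by
  have h := (measurePreserving_add_right (volume : Measure (d → ℝ)) (zr m)).setIntegral_preimage_emb
    (measurableEmbedding_addRight _) g (cube m)
  rw [← h]
  congr 2
  ext x
  simp only [cube, zr, Set.mem_ofPred_eq, Set.mem_preimage, Set.mem_Ioc, Pi.add_apply, Pi.zero_apply, Int.cast_zero]
  constructor <;> intro h i <;> constructor <;> linarith [(h i).1, (h i).2]

lemma cube_hasSum {d : Type*} [Fintype d] {E : Type*} [NormedAddCommGroup E] [NormedSpace ℝ E]
    (g : (d → ℝ) → E) (hg : Integrable g) :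
    HasSum (fun m => ∫ x in cube 0, g (x + zr m)) (∫ x, g x) := by
  simp only [cube_int]
  have := hasSum_integral_iUnion (μ := (volume : Measure (d → ℝ))) (f := g)
    (s := fun m : d → ℤ => cube m) (fun m => cube_meas m)
    cube_disj (by rw [cube_union]; exact hg.integrableOn)
  rw [cube_union, setIntegral_univ] at this
  exact this

lemma cube_swap {d : Type*} [Fintype d] 
    (g : (d → ℝ) → ℂ) (hg : Integrable g) :
    ∫ x in cube 0, ∑' m : d → ℤ, g (x + zr m) = ∫ x, g x := by
  have h1 := cube_hasSum g hg
  have h2 := cube_hasSum (fun x => ‖g x‖) hg.norm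
  have h3 := hasSum_integral_of_summable_integral_norm (μ := volume.restrict (cube (0 : d → ℤ)))
    (F := fun (m : d → ℤ) x => g (x + zr m))
    (fun m => (hg.comp_add_right (zr m)).integrableOn) h2.summable
  exact h3.unique h1

/-- the pairing exponential -/
noncomputable def ee {d : Type*} [Fintype d] (k : d → ℤ) (x : d → ℝ) : ℂ :=
  cexp (2 * π * I * ((∑ i, (k i : ℝ) * x i : ℝ) : ℂ))

lemma ee_eq {d : Type*} [Fintype d] (k : d → ℤ) (x : d → ℝ) :
    UnitAddTorus.mFourier k (fun i => (x i : UnitAddCircle)) = ee k x := by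
  unfold UnitAddTorus.mFourier ee
  simp only [ContinuousMap.coe_mk, fourier_coe_apply]
  rw [← Complex.exp_sum]
  congr 1
  push_cast
  rw [Finset.mul_sum]
  refine Finset.sum_congr rfl fun i _ => ?_
  ring

lemma ee_zr {d : Type*} [Fintype d] (k m : d → ℤ) (x : d → ℝ) : ee k (x + zr m) = ee k x := by
  rw [← ee_eq, ← ee_eq]
  congr 1
  funext i
  simp [zr]

lemma ee_norm {d : Type*} [Fintype d] (k : d → ℤ) (x : d → ℝ) : ‖ee k x‖ = 1 := by
  unfold ee
  rw [show 2 * π * I * ((∑ i, (k i : ℝ) * x i : ℝ) : ℂ) =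
    ((2 * π * (∑ i, (k i : ℝ) * x i) : ℝ) : ℂ) * I by push_cast; ring]
  exact Complex.norm_exp_ofReal_mul_I _

lemma ee_cont {d : Type*} [Fintype d] (k : d → ℤ) : Continuous (ee k) := by
  unfold ee; fun_prop

lemma poisson_pi {d : Type*} [Fintype d] (f : (d → ℝ) → ℂ) (hc : Continuous f)
    (hi : Integrable f) (B : (d → ℝ) → ℝ) (hB : Continuous B)
    (u : (d → ℤ) → ℝ) (hu : Summable u) (hu0 : ∀ m, 0 ≤ u m)
    (hb : ∀ x m, ‖f (x + zr m)‖ ≤ B x * u m)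
    (c : (d → ℤ) → ℂ) (hcoef : ∀ k, ∫ x, ee (-k) x * f x = c k) (hs : Summable c) (x : d → ℝ) :
    ∑' m : d → ℤ, f (x + zr m) = ∑' k, c k * ee k x := by
  set Φ : (d → ℝ) → ℂ := fun x => ∑' m : d → ℤ, f (x + zr m) with hΦ
  have hcont : Continuous Φ := by
    rw [continuous_iff_continuousAt]
    intro x0
    have ho : IsOpen {y | B y < B x0 + 1} := isOpen_lt hB continuous_const
    have : ContinuousOn Φ {y | B y < B x0 + 1} := by
      refine continuousOn_tsum (u := fun m => (B x0 + 1) * u m) ?_ (hu.mul_left _) ?_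
      · intro m; exact (hc.comp (continuous_add_const _)).continuousOn
      · intro m y hy
        exact (hb y m).trans (mul_le_mul_of_nonneg_right (le_of_lt hy) (hu0 m))
    exact this.continuousAt (ho.mem_nhds (by simp))
  have hper : ∀ x (m : d → ℤ), Φ (x + zr m) = Φ x := by
    intro x m
    simp only [hΦ]
    rw [← (Equiv.addLeft m).tsum_eq (fun k => f (x + zr k))]
    refine tsum_congr fun k => ?_
    congr 1
    funext i
    simp [zr, add_assoc]
  let P : C(d → ℝ, UnitAddTorus d) := ⟨fun x i => (x i : UnitAddCircle), by
    refine continuous_pi fun i => ?_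
    exact (AddCircle.continuous_mk' 1).comp (continuous_apply i)⟩
  have hP : IsQuotientMap P :=
    (IsOpenQuotientMap.piMap (f := fun (_ : d) (y : ℝ) => (y : UnitAddCircle))
      (fun i => QuotientAddGroup.isOpenQuotientMap_mk)).isQuotientMap
  have hfac : Function.FactorsThrough (⟨Φ, hcont⟩ : C(d → ℝ, ℂ)) P := by
    intro a b hab
    have : ∀ i, ∃ k : ℤ, a i = b i + k := by
      intro i
      have h1 : ((a i : ℝ) : UnitAddCircle) = ((b i : ℝ) : UnitAddCircle) := congrFun hab i
      have h2 : ((a i - b i : ℝ) : UnitAddCircle) = 0 := by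
        rw [AddCircle.coe_sub, h1, sub_self]
      obtain ⟨k, hk⟩ := (AddCircle.coe_eq_zero_iff 1).mp h2
      refine ⟨k, ?_⟩
      simp at hk
      linarith
    choose k hk using this
    have hab' : a = b + zr k := funext hk
    change Φ a = Φ b
    rw [hab', hper]
  set F : C(UnitAddTorus d, ℂ) := hP.lift ⟨Φ, hcont⟩ hfac with hF
  have hFP : ∀ x : d → ℝ, F (fun i => (x i : UnitAddCircle)) = Φ x := by
    intro x
    have := hP.lift_comp ⟨Φ, hcont⟩ hfac
    exact congrArg (fun g : C(d → ℝ, ℂ) => g x) this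
  have hco : ∀ k, UnitAddTorus.mFourierCoeff F k = c k := by
    intro k
    rw [UnitAddTorus.mFourierCoeff_eq_integral F k 0, ← hcoef k]
    have hI : Integrable (fun x => ee (-k) x * f x) := by
      refine hi.bdd_mul (c := 1) (ee_cont _).aestronglyMeasurable ?_
      exact Eventually.of_forall fun x => (ee_norm _ _).le
    rw [← cube_swap _ hI]
    have : {x : d → ℝ | ∀ i, x i ∈ Set.Ioc ((0 : d → ℝ) i) ((0 : d → ℝ) i + 1)} = cube 0 := by
      ext x; simp [cube]
    rw [this]
    refine integral_congr_ae (Eventually.of_forall fun x => ?_)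
    simp only [ee_eq, hFP, ee_zr, smul_eq_mul]
    rw [tsum_mul_left]
  have hmain := UnitAddTorus.hasSum_mFourier_series_apply_of_summable (f := F)
    (by rw [funext hco]; exact hs) (fun i => (x i : UnitAddCircle))
  rw [hFP] at hmain
  simp only [hco, ee_eq, smul_eq_mul] at hmain
  exact hmain.tsum_eq.symm


section latt
variable {n : ℕ} (L : Submodule ℤ (EuclideanSpace ℝ (Fin n)))

lemma lat_adm [DiscreteTopology L] (x : EuclideanSpace ℝ (Fin n)) :
    Adm (fun v : L => ‖x + (v : EuclideanSpace ℝ (Fin n))‖ ^ 2) := by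
  refine ⟨fun v => by positivity, fun s hs => ?_⟩
  set k := Module.finrank ℤ L + 1 with hk
  have h := ZLattice.summable_norm_sub_inv_pow L (2 * k) (by omega) (-x)
  refine Summable.of_norm_bounded_eventually (h.mul_left ((k.factorial : ℝ) / s ^ k)) ?_
  have hfin : {v : L | (v : EuclideanSpace ℝ (Fin n)) = -x}.Finite := by
    apply Set.Subsingleton.finite
    intro a ha b hb
    exact Subtype.ext (ha.trans hb.symm)
  filter_upwards [hfin.compl_mem_cofinite] with v hv
  have hv' : (v : EuclideanSpace ℝ (Fin n)) ≠ -x := hv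
  rw [sub_neg_eq_add, add_comm _ x]
  have hr : 0 < ‖x + (v : EuclideanSpace ℝ (Fin n))‖ := by
    rw [norm_pos_iff]
    intro h0
    exact hv' (eq_neg_of_add_eq_zero_right h0)
  set r := ‖x + (v : EuclideanSpace ℝ (Fin n))‖
  rw [Real.norm_of_nonneg (Real.exp_nonneg _), Real.exp_neg]
  have h1 := Real.pow_div_factorial_le_exp (s * r ^ 2) (by positivity) k
  have h2 : 0 < (s * r ^ 2) ^ k / (k.factorial : ℝ) := by positivity
  calc (rexp (s * r ^ 2))⁻¹ ≤ ((s * r ^ 2) ^ k / (k.factorial : ℝ))⁻¹ := inv_anti₀ h2 h1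
    _ = _ := by
      rw [mul_pow, ← pow_mul, inv_div, inv_pow]
      field_simp

variable {L}

lemma lat_dual (hL : IsUnimodularLattice n L) {ι : Type*} [Fintype ι] [DecidableEq ι]
    (b : Module.Basis ι ℤ L) (bR : Module.Basis ι ℝ (EuclideanSpace ℝ (Fin n)))
    (hb : ∀ i, bR i = b i) :
    ∃ D : (ι → ℤ) ≃ L, ∀ k (x : EuclideanSpace ℝ (Fin n)),
      ⟪(D k : EuclideanSpace ℝ (Fin n)), x⟫ = ∑ i, (k i : ℝ) * bR.repr x i := by
  have hrep : ∀ (y : L) i, bR.repr (y : EuclideanSpace ℝ (Fin n)) i = (b.repr y i : ℝ) := by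
    intro y i
    have h1 : (y : EuclideanSpace ℝ (Fin n)) = ∑ i, (b.repr y i : ℝ) • bR i := by
      conv_lhs => rw [← b.sum_repr y]
      rw [Submodule.coe_sum]
      refine Finset.sum_congr rfl fun i _ => ?_
      rw [hb, Int.cast_smul_eq_zsmul]
      rfl
    conv_lhs => rw [h1]
    exact congrFun (bR.repr_sum_self (fun i => (b.repr y i : ℝ))) i
  have ex : ∀ k : ι → ℤ, ∃ v : L, ∀ x : EuclideanSpace ℝ (Fin n),
      ⟪(v : EuclideanSpace ℝ (Fin n)), x⟫ = ∑ i, (k i : ℝ) * bR.repr x i := by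
    intro k
    let φ : EuclideanSpace ℝ (Fin n) →ₗ[ℝ] ℝ := bR.constr ℝ (fun i => (k i : ℝ))
    have hφ : ∀ x, φ x = ∑ i, (k i : ℝ) * bR.repr x i := by
      intro x
      simp [φ, Module.Basis.constr_apply_fintype, mul_comm]
    let v := (InnerProductSpace.toDual ℝ (EuclideanSpace ℝ (Fin n))).symm
      (LinearMap.toContinuousLinearMap φ)
    have hv : ∀ x, ⟪v, x⟫ = ∑ i, (k i : ℝ) * bR.repr x i := by
      intro x
      rw [← hφ]
      simp [v]
    refine ⟨⟨v, ?_⟩, hv⟩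
    rw [hL.2.2]
    intro y hy
    refine ⟨∑ i, k i * b.repr ⟨y, hy⟩ i, ?_⟩
    rw [hv]
    push_cast
    refine Finset.sum_congr rfl fun i _ => ?_
    rw [← hrep]
  choose D hD using ex
  refine ⟨Equiv.ofBijective D ⟨?_, ?_⟩, hD⟩
  · intro k k' h
    funext i
    have h1 := hD k (bR i)
    have h2 := hD k' (bR i)
    rw [h, h2] at h1
    simp [Finsupp.single_apply] at h1
    exact h1.symm
  · intro v
    have := (hL.2.2 v).mp v.2
    choose k hk using fun i => this (b i) (b i).2
    refine ⟨k, Subtype.ext ?_⟩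
    refine InnerProductSpace.ext_inner_right_basis bR fun i => ?_
    rw [hD, hb, hk, ← hb]
    simp [Finsupp.single_apply]

lemma gauss_change (e : (Fin n → ℝ) ≃L[ℝ] EuclideanSpace ℝ (Fin n)) :
    ∃ C : ℝ, ∀ f : EuclideanSpace ℝ (Fin n) → ℂ, Continuous f →
      ∫ x, f (e x) = C * ∫ y, f y := by
  have h1 : (Measure.map e (volume : Measure (Fin n → ℝ))).IsAddHaarMeasure :=
    e.isAddHaarMeasure_map _
  have h2 := Measure.isAddLeftInvariant_eq_smul (Measure.map e (volume : Measure (Fin n → ℝ)))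
    (volume : Measure (EuclideanSpace ℝ (Fin n)))
  set c := Measure.addHaarScalarFactor (Measure.map e (volume : Measure (Fin n → ℝ)))
    (volume : Measure (EuclideanSpace ℝ (Fin n)))
  refine ⟨c, fun f hf => ?_⟩
  have h3 := integral_map (μ := (volume : Measure (Fin n → ℝ))) e.continuous.measurable.aemeasurable
    (f := f) hf.aestronglyMeasurable
  rw [← h3, h2, integral_smul_nnreal_measure]
  rfl

end latt


section latt2
variable {n : ℕ} {L : Submodule ℤ (EuclideanSpace ℝ (Fin n))}

/-- bundle of the basis data of a unimodular lattice -/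
lemma lat_basis (hL : IsUnimodularLattice n L) :
    ∃ (b : Module.Basis (Fin n) ℤ L) (bR : Module.Basis (Fin n) ℝ (EuclideanSpace ℝ (Fin n))),
      ∀ i, bR i = b i := by
  have : DiscreteTopology L := hL.1
  have : IsZLattice ℝ L := ⟨hL.2.1⟩
  have := ZLattice.module_free ℝ L
  have := ZLattice.module_finite ℝ L
  have hr : Module.finrank ℤ L = n := by
    rw [ZLattice.rank ℝ L, finrank_euclideanSpace_fin]
  let b := Module.finBasisOfFinrankEq ℤ L hr
  exact ⟨b, b.ofZLatticeBasis ℝ L, fun i => b.ofZLatticeBasis_apply ℝ L i⟩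

lemma gauss_integrable (e : (Fin n → ℝ) ≃L[ℝ] EuclideanSpace ℝ (Fin n)) (t : ℝ) (ht : 0 < t) :
    Integrable (fun x : Fin n → ℝ => cexp ((-(π * t * ‖e x‖ ^ 2) : ℝ) : ℂ)) := by
  have h0 : Integrable (fun y : EuclideanSpace ℝ (Fin n) => cexp ((-(π * t * ‖y‖ ^ 2) : ℝ) : ℂ))
      (Measure.map e (volume : Measure (Fin n → ℝ))) := by
    have : (Measure.map e (volume : Measure (Fin n → ℝ))).IsAddHaarMeasure :=
      e.isAddHaarMeasure_map _
    rw [Measure.isAddLeftInvariant_eq_smul (Measure.map e (volume : Measure (Fin n → ℝ)))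
      (volume : Measure (EuclideanSpace ℝ (Fin n)))]
    refine Integrable.smul_measure_nnreal ?_
    have := GaussianFourier.integrable_cexp_neg_mul_sq_norm_add (V := EuclideanSpace ℝ (Fin n))
      (b := ((π * t : ℝ) : ℂ)) (by rw [Complex.ofReal_re]; positivity) 0 0
    refine this.congr (Eventually.of_forall fun y => ?_)
    simp
  exact h0.comp_measurable e.continuous.measurable

lemma gauss_coef (t : ℝ) (ht : 0 < t) (v : EuclideanSpace ℝ (Fin n)) :
    ∫ y : EuclideanSpace ℝ (Fin n), cexp (2 * π * I * ((-⟪v, y⟫ : ℝ) : ℂ)) *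
      cexp ((-(π * t * ‖y‖ ^ 2) : ℝ) : ℂ) =
      (((√t : ℝ) : ℂ) ^ n)⁻¹ * cexp ((-(π * t⁻¹ * ‖v‖ ^ 2) : ℝ) : ℂ) := by
  have h := GaussianFourier.integral_cexp_neg_mul_sq_norm_add (V := EuclideanSpace ℝ (Fin n))
      (b := ((π * t : ℝ) : ℂ)) (by rw [Complex.ofReal_re]; positivity) (-(2 * π * I)) v
  have hpi : (π : ℂ) ≠ 0 := by exact_mod_cast Real.pi_ne_zero
  have ht0 : (t : ℂ) ≠ 0 := by exact_mod_cast ht.ne'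
  have e1 : ((π : ℂ) / ((π * t : ℝ) : ℂ)) ^
      ((Module.finrank ℝ (EuclideanSpace ℝ (Fin n)) : ℂ) / 2) = (((√t : ℝ) : ℂ) ^ n)⁻¹ := by
    rw [finrank_euclideanSpace_fin]
    have : (π : ℂ) / ((π * t : ℝ) : ℂ) = ((t⁻¹ : ℝ) : ℂ) := by
      push_cast; field_simp
    rw [this, show (n : ℂ) / 2 = (1 / 2 : ℂ) * n by ring, Complex.cpow_mul_nat,
      cpow_half _ (inv_pos.mpr ht), Real.sqrt_inv]
    push_cast
    rw [inv_pow]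
  rw [e1] at h
  calc _ = ∫ y : EuclideanSpace ℝ (Fin n), cexp (-((π * t : ℝ) : ℂ) * ‖y‖ ^ 2 +
        -(2 * π * I) * ⟪v, y⟫) := by
        refine integral_congr_ae (Eventually.of_forall fun y => ?_)
        simp only
        rw [← Complex.exp_add]
        congr 1
        push_cast
        ring
    _ = _ := by
        rw [h]
        congr 2
        push_cast
        field_simp
        linear_combination (4 : ℂ) * (‖v‖ : ℂ) ^ 2 * I_sq

lemma lat_poisson_aux (hL : IsUnimodularLattice n L) : ∃ C : ℂ,
    ∀ t : ℝ, 0 < t → ∀ x : EuclideanSpace ℝ (Fin n),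
    ∑' v : L, cexp ((-(π * t * ‖x + (v : EuclideanSpace ℝ (Fin n))‖ ^ 2) : ℝ) : ℂ) =
      C * (((√t : ℝ) : ℂ) ^ n)⁻¹ * ∑' v : L,
        cexp ((-(π * t⁻¹ * ‖(v : EuclideanSpace ℝ (Fin n))‖ ^ 2) : ℝ) : ℂ) *
          cexp (2 * π * I * ((⟪(v : EuclideanSpace ℝ (Fin n)), x⟫ : ℝ) : ℂ)) := by
  have : DiscreteTopology L := hL.1
  obtain ⟨b, bR, hb⟩ := lat_basis hL
  obtain ⟨D, hD⟩ := lat_dual hL b bR hb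
  let e : (Fin n → ℝ) ≃L[ℝ] EuclideanSpace ℝ (Fin n) := bR.equivFun.symm.toContinuousLinearEquiv
  have hDe : ∀ k x, ⟪(D k : EuclideanSpace ℝ (Fin n)), e x⟫ = ∑ i, (k i : ℝ) * x i := by
    intro k x
    rw [hD]
    refine Finset.sum_congr rfl fun i _ => ?_
    congr 1
    have : bR.equivFun (e x) = x := bR.equivFun.apply_symm_apply x
    exact congrFun this i
  let Z : (Fin n → ℤ) ≃ L := b.equivFun.symm.toEquiv
  have hZ : ∀ m, (Z m : EuclideanSpace ℝ (Fin n)) = e (zr m) := by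
    intro m
    change ((b.equivFun.symm m : L) : EuclideanSpace ℝ (Fin n)) = bR.equivFun.symm (zr m)
    rw [Module.Basis.equivFun_symm_apply, Module.Basis.equivFun_symm_apply, Submodule.coe_sum]
    refine Finset.sum_congr rfl fun i _ => ?_
    rw [hb, zr, Int.cast_smul_eq_zsmul]
    rfl
  obtain ⟨C, hC⟩ := gauss_change e
  refine ⟨C, fun t ht x => ?_⟩
  set f : (Fin n → ℝ) → ℂ := fun x => cexp ((-(π * t * ‖e x‖ ^ 2) : ℝ) : ℂ) with hf
  have hfc : Continuous f := by
    have := e.continuous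
    fun_prop
  have hpt : 0 < π * t := by positivity
  have hnf : ∀ x, ‖f x‖ = rexp (-(π * t * ‖e x‖ ^ 2)) := by
    intro x
    rw [hf]
    simp only
    rw [Complex.norm_exp, Complex.ofReal_re]
  have h0 : ∀ s : ℝ, 0 < s → Summable fun v : L => rexp (-(s * ‖(v : EuclideanSpace ℝ (Fin n))‖ ^ 2)) := by
    intro s hs
    have := (lat_adm L 0).2 s hs
    simpa using this
  have key := poisson_pi f hfc (gauss_integrable e t ht) (fun x => rexp (π * t * ‖e x‖ ^ 2))
    (by have := e.continuous; fun_prop)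
    (fun m => rexp (-(π * t / 2 * ‖(Z m : EuclideanSpace ℝ (Fin n))‖ ^ 2)))
    (Z.summable_iff.mpr (h0 (π * t / 2) (by positivity))) (fun m => (Real.exp_pos _).le)
    (by
      intro x m
      rw [hnf, ← Real.exp_add]
      apply Real.exp_le_exp.mpr
      rw [map_add, ← hZ]
      set a := e x
      set c := (Z m : EuclideanSpace ℝ (Fin n))
      have h1 : ‖c‖ ≤ ‖a + c‖ + ‖a‖ := by
        calc ‖c‖ = ‖(a + c) - a‖ := by congr 1; abel
          _ ≤ _ := norm_sub_le _ _
      have h2 : ‖c‖ ^ 2 ≤ 2 * (‖a + c‖ ^ 2 + ‖a‖ ^ 2) := by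
        have := pow_le_pow_left₀ (norm_nonneg c) h1 2
        nlinarith [sq_nonneg (‖a + c‖ - ‖a‖)]
      nlinarith [mul_le_mul_of_nonneg_left h2 hpt.le])
    (fun k => C * ((((√t : ℝ) : ℂ) ^ n)⁻¹ *
      cexp ((-(π * t⁻¹ * ‖(D k : EuclideanSpace ℝ (Fin n))‖ ^ 2) : ℝ) : ℂ)))
    (by
      intro k
      rw [← gauss_coef t ht, ← hC]
      · refine integral_congr_ae (Eventually.of_forall fun x => ?_)
        simp only [hf]
        congr 1
        unfold ee
        rw [hDe]
        congr 2
        push_cast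
        simp
      · fun_prop)
    (by
      refine Summable.mul_left _ (Summable.mul_left _ ?_)
      apply Summable.of_norm
      refine ((D.summable_iff).mpr (h0 (π * t⁻¹) (by positivity))).congr fun k => ?_
      rw [Complex.norm_exp, Complex.ofReal_re]
      rfl)
    (e.symm x)
  have l1 : ∑' m : Fin n → ℤ, f (e.symm x + zr m) =
      ∑' v : L, cexp ((-(π * t * ‖x + (v : EuclideanSpace ℝ (Fin n))‖ ^ 2) : ℝ) : ℂ) := by
    rw [← Z.tsum_eq]
    refine tsum_congr fun m => ?_
    simp only [hf]
    rw [map_add, hZ, e.apply_symm_apply]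
  rw [← l1, key, ← D.tsum_eq, ← tsum_mul_left]
  refine tsum_congr fun k => ?_
  have : ee k (e.symm x) = cexp (2 * π * I * ((⟪(D k : EuclideanSpace ℝ (Fin n)), x⟫ : ℝ) : ℂ)) := by
    unfold ee
    rw [← hDe, e.apply_symm_apply]
  rw [this]
  ring

lemma lat_poisson (hL : IsUnimodularLattice n L) 
    (t : ℝ) (ht : 0 < t) (x : EuclideanSpace ℝ (Fin n)) :
    ∑' v : L, cexp ((-(π * t * ‖x + (v : EuclideanSpace ℝ (Fin n))‖ ^ 2) : ℝ) : ℂ) =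
      (((√t : ℝ) : ℂ) ^ n)⁻¹ * ∑' v : L,
        cexp ((-(π * t⁻¹ * ‖(v : EuclideanSpace ℝ (Fin n))‖ ^ 2) : ℝ) : ℂ) *
          cexp (2 * π * I * ((⟪(v : EuclideanSpace ℝ (Fin n)), x⟫ : ℝ) : ℂ)) := by
  have : DiscreteTopology L := hL.1
  obtain ⟨C, hC⟩ := lat_poisson_aux hL
  have h1 := hC 1 one_pos 0
  simp only [zero_add, inner_zero_right, Complex.ofReal_zero, mul_zero, Complex.exp_zero,
    Real.sqrt_one, Complex.ofReal_one, one_pow, inv_one, mul_one] at h1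
  have hs := (lat_adm L 0).2 π Real.pi_pos
  simp only [zero_add] at hs
  have h2 : ∑' v : L, cexp ((-(π * ‖(v : EuclideanSpace ℝ (Fin n))‖ ^ 2) : ℝ) : ℂ) ≠ 0 := by
    have : 0 < ∑' v : L, rexp (-(π * ‖(v : EuclideanSpace ℝ (Fin n))‖ ^ 2)) :=
      hs.tsum_pos (fun v => (Real.exp_pos _).le) 0 (Real.exp_pos _)
    have h3 : ((∑' v : L, rexp (-(π * ‖(v : EuclideanSpace ℝ (Fin n))‖ ^ 2)) : ℝ) : ℂ) ≠ 0 := by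
      exact_mod_cast this.ne'
    rw [Complex.ofReal_tsum] at h3
    simpa using h3
  have hC1 : C = 1 := by
    have : (C - 1) * ∑' v : L, cexp ((-(π * ‖(v : EuclideanSpace ℝ (Fin n))‖ ^ 2) : ℝ) : ℂ) = 0 := by
      rw [sub_mul, one_mul, ← h1, sub_self]
    rcases mul_eq_zero.mp this with h | h
    · exact sub_eq_zero.mp h
    · exact absurd h h2
  rw [hC t ht x, hC1, one_mul]

end latt2


section latt3
variable {n : ℕ} {L : Submodule ℤ (EuclideanSpace ℝ (Fin n))}

lemma lat_int (hL : IsUnimodularLattice n L) {x y : EuclideanSpace ℝ (Fin n)}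
    (hx : x ∈ L) (hy : y ∈ L) : ∃ k : ℤ, ⟪x, y⟫ = (k : ℝ) :=
  (hL.2.2 x).mp hx y hy

lemma lat_norm_int (hL : IsUnimodularLattice n L) (v : L) :
    ∃ k : ℤ, ‖(v : EuclideanSpace ℝ (Fin n))‖ ^ 2 = (k : ℝ) := by
  obtain ⟨k, hk⟩ := lat_int hL v.2 v.2
  exact ⟨k, by rw [← hk, real_inner_self_eq_norm_sq]⟩

lemma exists_char (hL : IsUnimodularLattice n L) : ∃ w, IsCharacteristic n L w := by
  obtain ⟨b, bR, hb⟩ := lat_basis hL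
  obtain ⟨D, hD⟩ := lat_dual hL b bR hb
  choose k hk using fun i => lat_int hL (b i).2 (b i).2
  refine ⟨D k, (D k).2, ?_⟩
  set w : EuclideanSpace ℝ (Fin n) := (D k : EuclideanSpace ℝ (Fin n)) with hwdef
  have hwb : ∀ i, ⟪w, (b i : EuclideanSpace ℝ (Fin n))⟫ = (k i : ℝ) := by
    intro i
    rw [hwdef, hD, ← hb]
    simp [Finsupp.single_apply]
  have main : ∀ x : L, ∃ k : ℤ, ⟪w, (x : EuclideanSpace ℝ (Fin n))⟫ -
      ⟪(x : EuclideanSpace ℝ (Fin n)), (x : EuclideanSpace ℝ (Fin n))⟫ = 2 * (k : ℝ) := by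
    intro x
    have hx : x ∈ Submodule.span ℤ (Set.range b) := by rw [b.span_eq]; trivial
    induction hx using Submodule.span_induction with
    | mem x h =>
      obtain ⟨i, rfl⟩ := h
      exact ⟨0, by rw [hwb, hk]; simp⟩
    | zero => exact ⟨0, by simp⟩
    | add x y _ _ hx hy =>
      obtain ⟨p, hp⟩ := hx
      obtain ⟨q, hq⟩ := hy
      obtain ⟨r, hr⟩ := lat_int hL x.2 y.2
      refine ⟨p + q - r, ?_⟩
      rw [Submodule.coe_add, inner_add_right, real_inner_add_add_self, hr]
      push_cast
      linarith
    | smul a x _ hx =>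
      obtain ⟨p, hp⟩ := hx
      obtain ⟨r, hr⟩ := lat_int hL x.2 x.2
      obtain ⟨s, hs⟩ := Int.even_mul_succ_self (a - 1)
      have hs' : ((a : ℝ) - 1) * a = s + s := by
        have : (((a - 1) * (a - 1 + 1) : ℤ) : ℝ) = ((s + s : ℤ) : ℝ) := by rw [hs]
        push_cast at this
        linarith
      refine ⟨a * p - s * r, ?_⟩
      have e1 : ((a • x : L) : EuclideanSpace ℝ (Fin n)) = (a : ℝ) • (x : EuclideanSpace ℝ (Fin n)) := by
        rw [Int.cast_smul_eq_zsmul]; rfl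
      rw [e1, inner_smul_right, inner_smul_right, real_inner_smul_left]
      rw [hr] at hp ⊢
      push_cast
      linear_combination (a : ℝ) * hp - (r : ℝ) * hs'
  exact fun x hx => main ⟨x, hx⟩

/-- theta series of a translate of the lattice -/
noncomputable def lth (L : Submodule ℤ (EuclideanSpace ℝ (Fin n)))
    (x : EuclideanSpace ℝ (Fin n)) : ℂ → ℂ :=
  gth (fun v : L => ‖x + (v : EuclideanSpace ℝ (Fin n))‖ ^ 2)

lemma lth_two (hL : IsUnimodularLattice n L) (z : ℂ) : lth L 0 (z + 2) = lth L 0 z := by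
  unfold lth gth
  refine tsum_congr fun v => ?_
  obtain ⟨k, hk⟩ := lat_norm_int hL v
  simp only [zero_add]
  rw [hk, mul_add, Complex.exp_add]
  have := exp_pi_even k
  rw [show (π : ℂ) * I * ((k : ℝ) : ℂ) * 2 = π * I * (2 * k) by push_cast; ring, this, mul_one]

lemma lth_S (hL : IsUnimodularLattice n L) (t : ℝ) (ht : 0 < t) :
    lth L 0 (I * (t⁻¹ : ℝ)) = ((√t : ℝ) : ℂ) ^ n * lth L 0 (I * t) := by
  have h := lat_poisson hL t ht 0
  have hs : ((√t : ℝ) : ℂ) ≠ 0 := by exact_mod_cast (Real.sqrt_pos.mpr ht).ne'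
  simp only [inner_zero_right, Complex.ofReal_zero, mul_zero, Complex.exp_zero, mul_one] at h
  unfold lth gth
  simp only [I_sq_mul]
  rw [h, ← mul_assoc, mul_inv_cancel₀ (pow_ne_zero n hs), one_mul]
  simp only [zero_add]

lemma lth_ST (hL : IsUnimodularLattice n L) (w : EuclideanSpace ℝ (Fin n))
    (hw : IsCharacteristic n L w) (t : ℝ) (ht : 0 < t) :
    lth L 0 (I * (t⁻¹ : ℝ) + 1) = ((√t : ℝ) : ℂ) ^ n * lth L ((1 / 2 : ℝ) • w) (I * t) := by
  have h := lat_poisson hL t ht ((1 / 2 : ℝ) • w)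
  have hs : ((√t : ℝ) : ℂ) ≠ 0 := by exact_mod_cast (Real.sqrt_pos.mpr ht).ne'
  unfold lth gth
  simp only [mul_add, I_sq_mul]
  rw [h, ← mul_assoc, mul_inv_cancel₀ (pow_ne_zero n hs), one_mul]
  refine tsum_congr fun v => ?_
  rw [zero_add, Complex.exp_add]
  congr 1
  obtain ⟨k, hk⟩ := hw.2 v v.2
  rw [inner_smul_right, real_inner_comm]
  rw [real_inner_self_eq_norm_sq] at hk
  have hk' : ⟪w, (v : EuclideanSpace ℝ (Fin n))⟫ =
    ‖(v : EuclideanSpace ℝ (Fin n))‖ ^ 2 + 2 * k := by linarith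
  rw [hk']
  have := exp_pi_even k
  rw [show 2 * (π : ℂ) * I * ((1 / 2 * (‖(v : EuclideanSpace ℝ (Fin n))‖ ^ 2 + 2 * k) : ℝ) : ℂ) =
    π * I * ((‖(v : EuclideanSpace ℝ (Fin n))‖ ^ 2 : ℝ) : ℂ) * 1 + π * I * (2 * k) by
      push_cast; ring, Complex.exp_add, this]
  simp

lemma lth_diff (hL : IsUnimodularLattice n L) (x : EuclideanSpace ℝ (Fin n)) :
    DifferentiableOn ℂ (lth L x) UU := by
  have : DiscreteTopology L := hL.1
  exact gth_diff (lat_adm L x)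

lemma lth_bound_char (hL : IsUnimodularLattice n L) (w : EuclideanSpace ℝ (Fin n))
    (hw : IsCharacteristic n L w)
    (hc : ∀ w, IsCharacteristic n L w → (n : ℝ) - 8 ≤ ⟪w, w⟫) :
    lth L ((1 / 2 : ℝ) • w) =O[LL] fun z => rexp (-(π * (((n : ℝ) - 8) / 4) * z.im)) := by
  have : DiscreteTopology L := hL.1
  refine gth_bound (lat_adm L _) _ fun v => ?_
  have hch : IsCharacteristic n L (w + (2 : ℤ) • (v : EuclideanSpace ℝ (Fin n))) := by
    refine ⟨L.add_mem hw.1 (L.smul_mem _ v.2), fun x hx => ?_⟩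
    obtain ⟨k, hk⟩ := hw.2 x hx
    obtain ⟨m, hm⟩ := lat_int hL v.2 hx
    refine ⟨k + m, ?_⟩
    rw [inner_add_left, two_zsmul, inner_add_left, hm]
    push_cast
    linarith
  have h2 := hc _ hch
  have h3 : w + (2 : ℤ) • (v : EuclideanSpace ℝ (Fin n)) =
      (2 : ℝ) • ((1 / 2 : ℝ) • w + (v : EuclideanSpace ℝ (Fin n))) := by
    rw [smul_add, smul_smul, two_zsmul, two_smul]
    norm_num
  rw [h3, real_inner_self_eq_norm_sq, norm_smul, mul_pow] at h2
  norm_num at h2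
  norm_num
  linarith

lemma lth_bound_zero (hL : IsUnimodularLattice n L)
    (h1 : ∀ x ∈ L, ⟪x, x⟫ ≠ (1 : ℝ)) :
    (fun z => lth L 0 z - 1) =O[LL] fun z => rexp (-(2 * π * z.im)) := by
  have : DiscreteTopology L := hL.1
  have hA := lat_adm L 0
  have hb := gth_bound (hA.sub' {0}) 2 (by
    rintro ⟨v, hv⟩
    obtain ⟨k, hk⟩ := lat_norm_int hL v
    have hv0 : (v : EuclideanSpace ℝ (Fin n)) ≠ 0 := by
      intro h
      apply hv
      simpa using h
    have hp : 0 < ‖(v : EuclideanSpace ℝ (Fin n))‖ ^ 2 := by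
      have := norm_pos_iff.mpr hv0
      positivity
    have hne := h1 v v.2
    rw [real_inner_self_eq_norm_sq] at hne
    rw [zero_add]
    rw [hk] at hp hne ⊢
    have h3 : 0 < k := by exact_mod_cast hp
    have h4 : k ≠ 1 := by exact_mod_cast hne
    have : 2 ≤ k := by omega
    exact_mod_cast this)
  refine (hb.congr' ?_ ?_)
  · filter_upwards [UU_eventually] with z hz
    have := gth_split hA {0} hz
    unfold lth
    rw [this]
    simp
  · refine Eventually.of_forall fun z => ?_
    simp only
    congr 1; ring

lemma lth_real (hL : IsUnimodularLattice n L) (y : ℝ) (hy : 0 < y) :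
    1 ≤ (lth L 0 (I * y)).re := by
  have : DiscreteTopology L := hL.1
  have hs := (lat_adm L 0).2 (π * y) (by positivity)
  unfold lth gth
  simp only [I_sq_mul, ← Complex.ofReal_exp]
  rw [← Complex.ofReal_tsum, Complex.ofReal_re]
  have := hs.le_tsum 0 (fun v _ => (Real.exp_pos _).le)
  simpa using this

end latt3


/-! ### q-expansions -/

noncomputable def qq (z : ℂ) : ℂ := cexp (π * I * z)
noncomputable def pp (z : ℂ) : ℂ := cexp (π * I * (1 / 4 : ℝ) * z)

lemma qq_norm (z : ℂ) : ‖qq z‖ = rexp (-(π * z.im)) := by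
  have := norm_term 1 z
  simpa [qq] using this

lemma pp_norm (z : ℂ) : ‖pp z‖ = rexp (-(π * z.im * (1 / 4))) := norm_term (1 / 4) z

lemma pp_four (z : ℂ) : pp z ^ 4 = qq z := by
  unfold pp qq
  rw [← Complex.exp_nat_mul]
  congr 1
  push_cast
  ring

lemma LL_pos : ∀ᶠ z in LL, (1 : ℝ) ≤ z.im := tendsto_comap.eventually (eventually_ge_atTop 1)

lemma qq_le : ∀ᶠ z in LL, ‖qq z‖ ≤ 1 := by
  filter_upwards [LL_pos] with z hz
  rw [qq_norm, Real.exp_le_one_iff]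
  have := Real.pi_pos
  nlinarith

lemma pp_le : ∀ᶠ z in LL, ‖pp z‖ ≤ 1 := by
  filter_upwards [LL_pos] with z hz
  rw [pp_norm, Real.exp_le_one_iff]
  have := Real.pi_pos
  nlinarith

lemma qq_one : qq =O[LL] (fun _ => (1 : ℂ)) := by
  refine IsBigO.of_bound 1 ?_
  filter_upwards [qq_le] with z hz
  simpa using hz

lemma pp_one : pp =O[LL] (fun _ => (1 : ℂ)) := by
  refine IsBigO.of_bound 1 ?_
  filter_upwards [pp_le] with z hz
  simpa using hz

lemma qq_pow_le {a b : ℕ} (h : a ≤ b) : (fun z => qq z ^ b) =O[LL] fun z => qq z ^ a := by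
  refine IsBigO.of_bound 1 ?_
  filter_upwards [qq_le] with z hz
  rw [norm_pow, norm_pow, one_mul]
  exact pow_le_pow_of_le_one (norm_nonneg _) hz h

lemma pp_pow_le {a b : ℕ} (h : a ≤ b) : (fun z => pp z ^ b) =O[LL] fun z => pp z ^ a := by
  refine IsBigO.of_bound 1 ?_
  filter_upwards [pp_le] with z hz
  rw [norm_pow, norm_pow, one_mul]
  exact pow_le_pow_of_le_one (norm_nonneg _) hz h

/-- congruence modulo `q³` between bounded functions -/
def Cong (f g : ℂ → ℂ) : Prop :=
  (fun z => f z - g z) =O[LL] (fun z => qq z ^ 3) ∧ g =O[LL] (fun _ => (1 : ℂ))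

lemma Cong.bdd {f g : ℂ → ℂ} (h : Cong f g) : f =O[LL] (fun _ => (1 : ℂ)) := by
  have h1 := h.1.trans (qq_pow_le (Nat.zero_le 3))
  simp only [pow_zero] at h1
  have := h1.add h.2
  simpa using this

lemma Cong.mul {f g f' g' : ℂ → ℂ} (h : Cong f g) (h' : Cong f' g') :
    Cong (fun z => f z * f' z) (fun z => g z * g' z) := by
  constructor
  · have e1 := h.1.mul h'.bdd
    have e2 := h.2.mul h'.1
    simp only [one_mul, mul_one] at e1 e2
    refine (e1.add e2).congr_left fun z => ?_
    ring
  · simpa using h.2.mul h'.2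

lemma Cong.add {f g f' g' : ℂ → ℂ} (h : Cong f g) (h' : Cong f' g') :
    Cong (fun z => f z + f' z) (fun z => g z + g' z) := by
  constructor
  · refine (h.1.add h'.1).congr_left fun z => ?_
    ring
  · exact h.2.add h'.2

lemma Cong.const (c : ℂ) : Cong (fun _ => c) (fun _ => c) := by
  constructor
  · simp only [sub_self]; exact isBigO_zero _ _
  · exact isBigO_const_const _ one_ne_zero _

/-- reduce the right-hand side modulo `q³` -/
lemma Cong.red {f g : ℂ → ℂ} (h : Cong f g) (g' r : ℂ → ℂ) (hr : r =O[LL] (fun _ => (1 : ℂ)))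
    (e : ∀ z, g z = g' z + qq z ^ 3 * r z) : Cong f g' := by
  have h3 : (fun z => qq z ^ 3 * r z) =O[LL] fun z => qq z ^ 3 := by
    simpa using (isBigO_refl (fun z => qq z ^ 3) LL).mul hr
  constructor
  · refine (h.1.add h3).congr_left fun z => ?_
    rw [e]; ring
  · have h4 := h3.trans (qq_pow_le (Nat.zero_le 3))
    simp only [pow_zero] at h4
    refine (h.2.sub h4).congr_left fun z => ?_
    rw [e]; ring

lemma poly_bdd (a b c : ℂ) : (fun z => a + b * qq z + c * qq z ^ 2) =O[LL] (fun _ => (1 : ℂ)) := by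
  have h1 : (fun _ : ℂ => a) =O[LL] (fun _ => (1 : ℂ)) := isBigO_const_const _ one_ne_zero _
  have h2 := qq_one.const_mul_left b
  have h3 := (qq_one.pow 2).const_mul_left c
  simp only [one_pow] at h3
  exact (h1.add h2).add h3

lemma th3_exp : Cong th3 (fun z => 1 + 2 * qq z) := by
  constructor
  · have hb := gth_bound (adm_r3.sub' {-1, 0, 1}) 4 (by
      rintro ⟨m, hm⟩
      simp only [Finset.mem_insert, Finset.mem_singleton, not_or] at hm
      simp only [r3]
      have : 4 ≤ m ^ 2 := by
        rcases lt_or_ge m 0 with h | h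
        · have : m ≤ -2 := by omega
          nlinarith
        · have : 2 ≤ m := by omega
          nlinarith
      exact_mod_cast this)
    have h4 : (fun z : ℂ => rexp (-(π * 4 * z.im))) =O[LL] fun z => qq z ^ 4 := by
      refine IsBigO.of_bound 1 (Eventually.of_forall fun z => ?_)
      rw [norm_pow, qq_norm, ← Real.exp_nat_mul, Real.norm_of_nonneg (Real.exp_nonneg _), one_mul]
      apply Real.exp_le_exp.mpr
      push_cast
      linarith
    refine ((hb.trans h4).trans (qq_pow_le (by norm_num))).congr' ?_ EventuallyEq.rfl
    filter_upwards [UU_eventually] with z hz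
    have := gth_split adm_r3 {-1, 0, 1} hz
    unfold th3
    rw [this]
    simp [r3, qq]
    ring
  · simpa using poly_bdd 1 2 0

lemma tendsto_add_one_LL : Tendsto (fun z : ℂ => z + 1) LL LL := by
  unfold LL
  rw [tendsto_comap_iff]
  refine tendsto_comap.congr fun z => ?_
  simp

lemma qq_add_one (z : ℂ) : qq (z + 1) = - qq z := by
  unfold qq
  rw [mul_add, Complex.exp_add, mul_one, Complex.exp_pi_mul_I]
  ring

lemma th4_exp : Cong th4 (fun z => 1 - 2 * qq z) := by
  constructor
  · have := th3_exp.1.comp_tendsto tendsto_add_one_LL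
    refine (this.congr_left fun z => ?_).trans (IsBigO.of_bound 1 (Eventually.of_forall fun z => ?_))
    · simp only [Function.comp, qq_add_one]
      rw [th3_one]; ring
    · simp [qq_add_one]
  · have := poly_bdd 1 (-2) 0
    refine this.congr_left fun z => ?_
    ring

lemma th2_sub : (fun z => th2 z - 2 * pp z) =O[LL] fun z => pp z ^ 9 := by
  have hb := gth_bound (adm_r2.sub' {-1, 0}) (9 / 4) (by
    rintro ⟨m, hm⟩
    simp only [Finset.mem_insert, Finset.mem_singleton, not_or] at hm
    simp only [r2]
    rcases lt_or_ge m 0 with h | h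
    · have h2 : m ≤ -2 := by omega
      have : (m : ℝ) ≤ -2 := by exact_mod_cast h2
      nlinarith
    · have h2 : 1 ≤ m := by omega
      have : (1 : ℝ) ≤ m := by exact_mod_cast h2
      nlinarith)
  have h4 : (fun z : ℂ => rexp (-(π * (9 / 4) * z.im))) =O[LL] fun z => pp z ^ 9 := by
    refine IsBigO.of_bound 1 (Eventually.of_forall fun z => ?_)
    rw [norm_pow, pp_norm, ← Real.exp_nat_mul, Real.norm_of_nonneg (Real.exp_nonneg _), one_mul]
    apply Real.exp_le_exp.mpr
    push_cast
    linarith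
  refine (hb.trans h4).congr' ?_ EventuallyEq.rfl
  filter_upwards [UU_eventually] with z hz
  have := gth_split adm_r2 {-1, 0} hz
  unfold th2
  rw [this]
  have e1 : r2 (-1) = 1 / 4 := by norm_num [r2]
  have e2 : r2 0 = 1 / 4 := by norm_num [r2]
  rw [Finset.sum_pair (by norm_num), e1, e2]
  unfold pp
  ring

lemma th2_O : th2 =O[LL] pp := by
  have h1 := th2_sub.trans (pp_pow_le (show 1 ≤ 9 by norm_num))
  simp only [pow_one] at h1
  have h2 := h1.add ((isBigO_refl pp LL).const_mul_left 2)
  simpa using h2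

lemma th2_exp : Cong (fun z => th2 z ^ 4) (fun z => 16 * qq z) := by
  constructor
  · have hp := isBigO_refl pp LL
    have h2 : (fun z => th2 z ^ 3 + th2 z ^ 2 * (2 * pp z) + th2 z * (2 * pp z) ^ 2 +
        (2 * pp z) ^ 3) =O[LL] fun z => pp z ^ 3 := by
      have hp2 : (fun z => 2 * pp z) =O[LL] pp := hp.const_mul_left 2
      have a1 := th2_O.pow 3
      have a2 := (th2_O.pow 2).mul hp2
      have a3 := th2_O.mul (hp2.pow 2)
      have a4 := hp2.pow 3
      have a2' := a2.trans (IsBigO.of_bound 1 (Eventually.of_forall fun z => by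
        rw [one_mul]; exact le_of_eq (by ring_nf)) : _ =O[LL] fun z => pp z ^ 3)
      have a3' := a3.trans (IsBigO.of_bound 1 (Eventually.of_forall fun z => by
        rw [one_mul]; exact le_of_eq (by ring_nf)) : _ =O[LL] fun z => pp z ^ 3)
      exact ((a1.add a2').add a3').add a4
    have h3 := th2_sub.mul h2
    have e : ∀ z, pp z ^ 9 * pp z ^ 3 = qq z ^ 3 := fun z => by rw [← pp_four]; ring
    simp only [e] at h3
    refine h3.congr_left fun z => ?_
    beta_reduce
    rw [← pp_four]
    ring
  · have := poly_bdd 0 16 0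
    simpa using this

lemma th3_pow (k : ℕ) : Cong (fun z => th3 z ^ k)
    (fun z => 1 + 2 * k * qq z + 2 * k * (k - 1) * qq z ^ 2) := by
  induction k with
  | zero => simpa using Cong.const 1
  | succ k ih =>
    have h := ih.mul th3_exp
    simp only [← pow_succ] at h
    refine h.red _ (fun _ => 4 * k * (k - 1)) (isBigO_const_const _ one_ne_zero _) fun z => ?_
    push_cast
    ring

lemma th4_pow (k : ℕ) : Cong (fun z => th4 z ^ k)
    (fun z => 1 - 2 * k * qq z + 2 * k * (k - 1) * qq z ^ 2) := by
  induction k with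
  | zero => simpa using Cong.const 1
  | succ k ih =>
    have h := ih.mul th4_exp
    simp only [← pow_succ] at h
    refine h.red _ (fun _ => -(4 * k * (k - 1))) (isBigO_const_const _ one_ne_zero _) fun z => ?_
    push_cast
    ring

/-- the explicit candidate for the theta series -/
noncomputable def AA (n : ℕ) (z : ℂ) : ℂ :=
  th3 z ^ n - (n : ℂ) / 8 * (th3 z ^ (n - 8) * th2 z ^ 4 * th4 z ^ 4)

lemma AA_exp (n : ℕ) (hn : 8 ≤ n) :
    Cong (AA n) (fun z => 1 + 2 * n * (23 - n) * qq z ^ 2) := by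
  have hcast : ((n - 8 : ℕ) : ℂ) = n - 8 := by rw [Nat.cast_sub hn]; norm_num
  have h1 := ((th3_pow (n - 8)).mul th2_exp).mul (th4_pow 4)
  have h2 := (th3_pow n).add ((Cong.const (-((n : ℂ) / 8))).mul h1)
  have hA : AA n = fun z => th3 z ^ n +
      -((n : ℂ) / 8) * (th3 z ^ (n - 8) * th2 z ^ 4 * th4 z ^ 4) := by
    funext z
    unfold AA
    ring
  rw [← hA, hcast] at h2
  set k : ℂ := (n : ℂ) - 8 with hk
  refine h2.red _ (fun z => -((n : ℂ) / 8) * 16 * ((24 - 16 * k + 2 * k * (k - 1)) +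
    (48 * k - 16 * k * (k - 1)) * qq z + 48 * k * (k - 1) * qq z ^ 2)) ?_ fun z => ?_
  · exact (poly_bdd _ _ _).const_mul_left _
  · have : (n : ℂ) = k + 8 := by rw [hk]; ring
    rw [this]
    push_cast
    ring

lemma modular_apply {n : ℕ} {L : Submodule ℤ (EuclideanSpace ℝ (Fin n))}
    (hL : IsUnimodularLattice n L) (hn : 8 ≤ n)
    (h1 : ∀ x ∈ L, ⟪x, x⟫ ≠ (1 : ℝ))
    (hc : ∀ w, IsCharacteristic n L w → (n : ℝ) - 8 ≤ ⟪w, w⟫) :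
    ∀ z ∈ UU, lth L 0 z = AA n z := by
  obtain ⟨w, hw⟩ := exists_char hL
  obtain ⟨k, rfl⟩ : ∃ k, n = k + 8 := ⟨n - 8, by omega⟩
  set c : ℂ := ((k + 8 : ℕ) : ℂ) / 8 with hcdef
  have hAA : ∀ z, AA (k + 8) z = th3 z ^ (k + 8) - c * (th3 z ^ k * th2 z ^ 4 * th4 z ^ 4) := by
    intro z; unfold AA; simp [hcdef]
  have dA : DifferentiableOn ℂ (AA (k + 8)) UU := by
    have e : AA (k + 8) = fun z => th3 z ^ (k + 8) - c * (th3 z ^ k * th2 z ^ 4 * th4 z ^ 4) :=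
      funext hAA
    rw [e]
    exact (th3_diff.pow _).sub
      ((((th3_diff.pow _).mul (th2_diff.pow _)).mul (th4_diff.pow _)).const_mul _)
  have hmain := modular_main (k + 8) (fun z => lth L 0 z - AA (k + 8) z)
    (fun z => lth L ((1 / 2 : ℝ) • w) z - th2 z ^ (k + 8) -
      c * (th2 z ^ k * (th3 z * th4 z) ^ 4))
    ((lth_diff hL 0).sub dA)
    (((lth_diff hL _).sub (th2_diff.pow _)).sub
      (((th2_diff.pow _).mul ((th3_diff.mul th4_diff).pow _)).const_mul _))
    (by
      intro z _
      simp only [hAA, lth_two hL, th3_two, th2_pow_two, th4_two])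
    (by
      intro t ht
      simp only [hAA, lth_S hL t ht, th3_S t ht, th2_S t ht, th4_S t ht]
      ring)
    (by
      intro t ht
      simp only [hAA, lth_ST hL w hw t ht, th3_one, th2_pow_one, th4_one, th3_S t ht,
        th2_S t ht, th4_S t ht]
      ring)
    (by
      have hA := (AA_exp (k + 8) hn).1.trans (qq_pow_le (show 2 ≤ 3 by norm_num))
      have hq : (fun z => qq z ^ 2) =O[LL] fun z => rexp (-(2 * π * z.im)) := by
        refine IsBigO.of_bound 1 (Eventually.of_forall fun z => ?_)
        rw [norm_pow, qq_norm, ← Real.exp_nat_mul, Real.norm_of_nonneg (Real.exp_nonneg _), one_mul]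
        apply Real.exp_le_exp.mpr
        push_cast
        linarith
      have hq2 := hq.const_mul_left (2 * ((k + 8 : ℕ) : ℂ) * (23 - ((k + 8 : ℕ) : ℂ)))
      refine (((lth_bound_zero hL h1).sub (hA.trans hq)).sub hq2).congr_left fun z => ?_
      ring)
    (by
      have hk : ((k + 8 : ℕ) : ℝ) - 8 = k := by push_cast; ring
      have hp : ∀ m : ℕ, k ≤ m → (fun z => pp z ^ m) =O[LL]
          fun z => rexp (-(π * (((k + 8 : ℕ) : ℝ) - 8) / 4 * z.im)) := by
        intro m hm
        refine (pp_pow_le hm).trans (IsBigO.of_bound 1 (Eventually.of_forall fun z => ?_))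
        rw [hk, norm_pow, pp_norm, ← Real.exp_nat_mul, Real.norm_of_nonneg (Real.exp_nonneg _),
          one_mul]
        apply Real.exp_le_exp.mpr
        linarith
      have b1 := lth_bound_char hL w hw hc
      have b1' : lth L ((1 / 2 : ℝ) • w) =O[LL]
          fun z => rexp (-(π * (((k + 8 : ℕ) : ℝ) - 8) / 4 * z.im)) := by
        refine b1.congr_right fun z => ?_
        congr 1; ring
      have b2 := (th2_O.pow (k + 8)).trans (hp (k + 8) (by omega))
      have b4 : (fun z => (th3 z * th4 z) ^ 4) =O[LL] fun _ => (1 : ℝ) :=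
        ((th3_exp.bdd.mul th4_exp.bdd).pow 4).trans (isBigO_const_const _ one_ne_zero _)
      have b3 := ((th2_O.pow k).trans (hp k le_rfl)).mul b4
      simp only [mul_one] at b3
      exact (b1'.sub b2).sub (b3.const_mul_left c))
  intro z hz
  exact sub_eq_zero.mp (hmain z hz)

lemma tendsto_I_mul_LL : Tendsto (fun y : ℝ => I * (y : ℂ)) atTop LL := by
  unfold LL
  rw [tendsto_comap_iff]
  refine tendsto_id.congr fun y => ?_
  simp

lemma final_contra {n : ℕ} {L : Submodule ℤ (EuclideanSpace ℝ (Fin n))}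
    (hL : IsUnimodularLattice n L) (hn : 23 < n)
    (h : ∀ z ∈ UU, lth L 0 z = AA n z) : False := by
  have hA := (AA_exp n (by omega)).1.comp_tendsto tendsto_I_mul_LL
  obtain ⟨K, hK⟩ := hA.bound
  have hn' : (23 : ℝ) < n := by exact_mod_cast hn
  set κ : ℝ := 2 * n * (23 - n) with hκ
  have hκ0 : κ < 0 := by
    rw [hκ]
    have : (0 : ℝ) < 2 * n := by linarith
    exact mul_neg_of_pos_of_neg this (by linarith)
  have hev : ∀ᶠ y : ℝ in atTop, -κ ≤ K * rexp (-(π * y)) := by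
    filter_upwards [hK, eventually_gt_atTop 0] with y hy hy0
    have hU : I * (y : ℂ) ∈ UU := by
      change 0 < (I * (y : ℂ)).im
      simpa using hy0
    have hq : qq (I * y) = ((rexp (-(π * y)) : ℝ) : ℂ) := by
      unfold qq
      rw [Complex.ofReal_exp]
      congr 1
      push_cast
      linear_combination (π : ℂ) * y * I_mul_I
    simp only [Function.comp, norm_pow, ← h _ hU, hq] at hy
    rw [Complex.norm_real, Real.norm_of_nonneg (Real.exp_nonneg _)] at hy
    set q := rexp (-(π * y)) with hqdef
    have hq0 : 0 < q := Real.exp_pos _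
    have h1 := lth_real hL y hy0
    have h2 := (Complex.re_le_norm _).trans hy
    have e : (1 + 2 * (n : ℂ) * (23 - n) * (q : ℂ) ^ 2) = ((1 + κ * q ^ 2 : ℝ) : ℂ) := by
      rw [hκ]; push_cast; ring
    rw [e, Complex.sub_re, Complex.ofReal_re] at h2
    have h3 : -κ * q ^ 2 ≤ (K * q) * q ^ 2 := by nlinarith
    exact le_of_mul_le_mul_right h3 (by positivity)
  have hlim : Tendsto (fun y : ℝ => K * rexp (-(π * y))) atTop (𝓝 (K * 0)) := by
    refine Tendsto.const_mul K (Real.tendsto_exp_neg_atTop_nhds_zero.comp ?_)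
    exact tendsto_id.const_mul_atTop Real.pi_pos
  have := ge_of_tendsto hlim hev
  rw [mul_zero] at this
  linarith

lemma lat_finite {n : ℕ} {L : Submodule ℤ (EuclideanSpace ℝ (Fin n))}
    (hL : IsUnimodularLattice n L) :
    {x : EuclideanSpace ℝ (Fin n) | x ∈ L ∧ ⟪x, x⟫ = (2 : ℝ)}.Finite := by
  have : DiscreteTopology L := hL.1
  have hs := (lat_adm L 0).2 1 one_pos
  have ht := hs.tendsto_cofinite_zero
  have hev := ht.eventually (gt_mem_nhds (Real.exp_pos (-2)))
  have hfin : {v : L | ¬ rexp (-(1 * ‖0 + (v : EuclideanSpace ℝ (Fin n))‖ ^ 2)) < rexp (-2)}.Finite :=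
    hev
  refine (hfin.image (fun v : L => (v : EuclideanSpace ℝ (Fin n)))).subset ?_
  rintro x ⟨hx, hx2⟩
  refine ⟨⟨x, hx⟩, ?_, rfl⟩
  rw [real_inner_self_eq_norm_sq] at hx2
  change ¬ rexp (-(1 * ‖0 + x‖ ^ 2)) < rexp (-2)
  rw [zero_add, one_mul, hx2]
  exact lt_irrefl _

end work

/-- A unimodular lattice in `ℝⁿ` with `n > 23` and no vectors of norm 1 has a
characteristic vector of norm strictly less than `n − 8`; equivalently, its number of
vectors of norm 2 strictly exceeds `2n(23 − n)`. -/
theorem exists_short_characteristic_of_rank_gt_23 (n : ℕ)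
    (L : Submodule ℤ (EuclideanSpace ℝ (Fin n))) (hL : IsUnimodularLattice n L)
    (hn : 23 < n)
    (h1 : ∀ x ∈ L, ⟪x, x⟫ ≠ (1 : ℝ)) :
    (∃ w : EuclideanSpace ℝ (Fin n), IsCharacteristic n L w ∧ ⟪w, w⟫ < (n : ℝ) - 8) ∧
    {x : EuclideanSpace ℝ (Fin n) | x ∈ L ∧ ⟪x, x⟫ = (2 : ℝ)}.Finite ∧
    2 * (n : ℤ) * (23 - (n : ℤ)) <
      ({x : EuclideanSpace ℝ (Fin n) | x ∈ L ∧ ⟪x, x⟫ = (2 : ℝ)}.ncard : ℤ) := by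
  refine ⟨?_, lat_finite hL, ?_⟩
  · by_contra hcon
    push Not at hcon
    exact final_contra hL hn (modular_apply hL (by omega) h1 hcon)
  · have h2 : 2 * (n : ℤ) * (23 - (n : ℤ)) < 0 := mul_neg_of_pos_of_neg (by omega) (by omega)
    exact h2.trans_le (Int.natCast_nonneg _)
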